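/- Exact second and third moments of the number of order-2 branches: for every integer n ≥ 4, ⟨S_{2,n}²⟩ = n(n−1)(n²−n−4)/(4(2n−3)(2n−5)), and for every integer n ≥ 5, ⟨S_{2,n}³⟩ = n(n−1)(n⁴−2n³−15n²+32n+8)/(8(2n−3)(2n−5)(2n−7)). -/

import Mathlib

open MeasureTheory ProbabilityTheory Filter
open scoped NNReal Topology

/-- Binary trees: every internal node has exactly two children. -/
inductive BinTree : Type
  | leaf : BinTree
  | node : BinTree → BinTree → BinTree
  deriving DecidableEq

namespace BinTree

/-- The magnitude of a binary tree is its number of leaves. -/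
def magnitude : BinTree → ℕ
  | leaf => 1
  | node l r => magnitude l + magnitude r

/-- The Horton–Strahler order of (the root of) a binary tree:
leaves have order 1; a node whose two children have distinct orders has the max of the two;
a node whose two children have equal order `r` has order `r + 1`. -/
def ord : BinTree → ℕ
  | leaf => 1
  | node l r => if ord l = ord r then ord l + 1 else max (ord l) (ord r)

/-- `branches k τ` is `S_{k,n}(τ)`, the number of Horton–Strahler branches of order `k`
in `τ`, i.e. the number of maximal connected paths of nodes of order `k`.  It counts the
nodes of order `k` that head a branch: a new branch head of order `ord l + 1` is created
exactly at a node whose two children have equal order `ord l`, and every leaf heads an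
order-1 branch. -/
def branches (k : ℕ) : BinTree → ℕ
  | leaf => if k = 1 then 1 else 0
  | node l r => branches k l + branches k r +
      (if ord l = ord r ∧ ord l + 1 = k then 1 else 0)

end BinTree

/-- `treesOf n` is the finite set `Ω_n` of binary trees of magnitude `n`. -/
def treesOf : ℕ → Finset BinTree
  | 0 => ∅
  | 1 => {BinTree.leaf}
  | (n+2) => (Finset.range (n+1)).attach.biUnion fun k =>
      ((treesOf (k.1+1)) ×ˢ (treesOf (n+1-k.1))).image fun p => BinTree.node p.1 p.2
  decreasing_by
  · have := Finset.mem_range.mp k.2; omega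
  · omega

/-- Expectation `⟨f⟩` under the uniform probability measure `P_n` on `Ω_n` (the random model). -/
noncomputable def expect (n : ℕ) (f : BinTree → ℝ) : ℝ :=
  (∑ τ ∈ treesOf n, f τ) / (treesOf n).card

namespace BinTree

lemma one_le_magnitude (τ : BinTree) : 1 ≤ τ.magnitude := by
  induction τ with
  | leaf => simp [magnitude]
  | node l r hl hr => simp only [magnitude]; omega

lemma one_le_ord (τ : BinTree) : 1 ≤ τ.ord := by
  induction τ with
  | leaf => simp [ord]
  | node l r hl hr => simp only [ord]; split_ifs <;> omega

lemma ord_eq_one_iff (τ : BinTree) : τ.ord = 1 ↔ τ = leaf := by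
  cases τ with
  | leaf => simp [ord]
  | node l r =>
    have hl := one_le_ord l
    have hr := one_le_ord r
    simp only [ord, reduceCtorEq, iff_false]
    split_ifs <;> omega

lemma branches_two_node (l r : BinTree) :
    branches 2 (node l r) =
      branches 2 l + branches 2 r + if l = leaf ∧ r = leaf then 1 else 0 := by
  have h : (ord l = ord r ∧ ord l + 1 = 2) ↔ (l = leaf ∧ r = leaf) := by
    rw [← ord_eq_one_iff, ← ord_eq_one_iff]; omega
  simp only [branches, h]

end BinTree

open BinTree

lemma mem_treesOf_iff (n : ℕ) (τ : BinTree) : τ ∈ treesOf n ↔ τ.magnitude = n := by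
  induction τ generalizing n with
  | leaf =>
    match n with
    | 0 => simp [treesOf, magnitude]
    | 1 => simp [treesOf, magnitude]
    | n + 2 => simp [treesOf, magnitude]
  | node l r hl hr =>
    have h1 := one_le_magnitude l
    have h2 := one_le_magnitude r
    match n with
    | 0 => simp [treesOf, magnitude]; omega
    | 1 => simp [treesOf, magnitude]; omega
    | n + 2 =>
      rw [treesOf]
      simp only [Finset.mem_biUnion, Finset.mem_attach, true_and, Finset.mem_image,
        Finset.mem_product, Prod.exists, node.injEq, magnitude]
      constructor
      · rintro ⟨⟨k, hk⟩, a, b, ⟨ha, hb⟩, rfl, rfl⟩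
        have := Finset.mem_range.mp hk
        rw [hl] at ha
        rw [hr] at hb
        simp only at ha hb
        omega
      · intro h
        refine ⟨⟨l.magnitude - 1, Finset.mem_range.mpr (by omega)⟩, l, r, ⟨?_, ?_⟩, rfl, rfl⟩
        · rw [hl]; simp only; omega
        · rw [hr]; simp only; omega

lemma sum_treesOf_add_two {M : Type*} [AddCommMonoid M] (n : ℕ) (f : BinTree → M) :
    ∑ τ ∈ treesOf (n + 2), f τ =
      ∑ p ∈ Finset.HasAntidiagonal.antidiagonal (n + 2),
        ∑ q ∈ treesOf p.1 ×ˢ treesOf p.2, f (node q.1 q.2) := by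
  rw [Finset.sum_sigma']
  symm
  refine Finset.sum_bij (fun x _ => node x.2.1 x.2.2) ?_ ?_ ?_ ?_
  · rintro ⟨⟨i, j⟩, l, r⟩ h
    simp only [Finset.mem_sigma, Finset.HasAntidiagonal.mem_antidiagonal, Finset.mem_product,
      mem_treesOf_iff] at h
    simp only [mem_treesOf_iff, magnitude]
    omega
  · rintro ⟨⟨i, j⟩, l, r⟩ h ⟨⟨i', j'⟩, l', r'⟩ h' e
    simp only [Finset.mem_sigma, Finset.HasAntidiagonal.mem_antidiagonal, Finset.mem_product,
      mem_treesOf_iff] at h h'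
    simp only [node.injEq] at e
    obtain ⟨rfl, rfl⟩ := e
    obtain ⟨-, rfl, rfl⟩ := h
    obtain ⟨-, rfl, rfl⟩ := h'
    rfl
  · intro τ h
    cases τ with
    | leaf => simp [mem_treesOf_iff, magnitude] at h
    | node l r =>
      rw [mem_treesOf_iff, magnitude] at h
      exact ⟨⟨(l.magnitude, r.magnitude), (l, r)⟩, by simp [mem_treesOf_iff, h], rfl⟩
  · intros; rfl

/-- The generating function of the binomial moments `∑ τ ∈ Ω_n, (S_{2,n}(τ)).choose j`. -/
noncomputable def binomialMomentSeries (j : ℕ) : PowerSeries ℝ :=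
  PowerSeries.mk fun n => ∑ τ ∈ treesOf n, ((branches 2 τ).choose j : ℝ)

lemma treesOf_two : treesOf 2 = {node leaf leaf} := by
  ext τ
  rw [mem_treesOf_iff, Finset.mem_singleton]
  constructor
  · intro h
    match τ with
    | leaf => simp [magnitude] at h
    | node leaf leaf => rfl
    | node (node a b) r =>
      have := one_le_magnitude a
      have := one_le_magnitude b
      have := one_le_magnitude r
      simp only [magnitude] at h; omega
    | node l (node a b) =>
      have := one_le_magnitude a
      have := one_le_magnitude b
      have := one_le_magnitude l
      simp only [magnitude] at h; omega
  · rintro rfl; rfl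

lemma sum_choose_branches_treesOf {n : ℕ} (hn : 3 ≤ n) (j : ℕ) :
    ∑ τ ∈ treesOf n, ((branches 2 τ).choose j : ℝ) =
      ∑ i ∈ Finset.HasAntidiagonal.antidiagonal j, ∑ p ∈ Finset.HasAntidiagonal.antidiagonal n,
        (∑ τ ∈ treesOf p.1, ((branches 2 τ).choose i.1 : ℝ)) *
          ∑ τ ∈ treesOf p.2, ((branches 2 τ).choose i.2 : ℝ) := by
  obtain ⟨m, rfl⟩ : ∃ m, n = m + 2 := ⟨n - 2, by omega⟩
  rw [sum_treesOf_add_two, Finset.sum_comm]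
  refine Finset.sum_congr rfl fun p hp => ?_
  simp_rw [Finset.sum_mul_sum, ← Finset.sum_product' (treesOf p.1)]
  rw [Finset.sum_comm]
  refine Finset.sum_congr rfl fun q hq => ?_
  rw [Finset.HasAntidiagonal.mem_antidiagonal] at hp
  simp only [Finset.mem_product, mem_treesOf_iff] at hq
  have h : ¬ (q.1 = leaf ∧ q.2 = leaf) := by
    rintro ⟨h1, h2⟩
    simp only [h1, h2, magnitude] at hq
    omega
  rw [branches_two_node, if_neg h, add_zero, Nat.add_choose_eq]
  push_cast
  rfl

lemma binomialMomentSeries_eq (j : ℕ) :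
    binomialMomentSeries j =
      (if j = 0 then PowerSeries.X else 0) + (if j = 1 then PowerSeries.X ^ 2 else 0) +
        ∑ i ∈ Finset.HasAntidiagonal.antidiagonal j, binomialMomentSeries i.1 * binomialMomentSeries i.2 := by
  ext n
  simp only [map_add, map_sum, PowerSeries.coeff_mul]
  simp only [binomialMomentSeries, PowerSeries.coeff_mk, apply_ite (PowerSeries.coeff n),
    PowerSeries.coeff_X, PowerSeries.coeff_X_pow, map_zero]
  match n with
  | 0 => simp [treesOf]
  | 1 =>
    simp [treesOf, Finset.Nat.antidiagonal_succ, branches]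
    cases j <;> simp
  | 2 =>
    have h : ∀ i ∈ Finset.HasAntidiagonal.antidiagonal j, ((Nat.choose 0 i.1 : ℝ) * (Nat.choose 0 i.2 : ℝ)) =
        (fun i : ℕ × ℕ => (((Nat.choose 0 i.1) * (Nat.choose 0 i.2) : ℕ) : ℝ)) i := by
      intros; push_cast; rfl
    simp [treesOf_two, Finset.Nat.antidiagonal_succ, treesOf, branches, ord]
    rw [Finset.sum_congr rfl h, ← Nat.cast_sum, ← Nat.add_choose_eq]
    match j with
    | 0 => simp
    | 1 => simp
    | j + 2 => simp [Nat.choose_eq_zero_of_lt]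
  | n + 3 =>
    rw [sum_choose_branches_treesOf (by omega)]
    simp

open PowerSeries in
lemma one_sub_two_mul_mul_derivative :
    (1 - 2 * binomialMomentSeries 0) * derivative ℝ (binomialMomentSeries 0) = 1 := by
  have h : binomialMomentSeries 0 = X + binomialMomentSeries 0 ^ 2 := by
    conv_lhs => rw [binomialMomentSeries_eq]
    simp [sq]
  have h' := congrArg (derivative ℝ) h
  simp only [map_add, Derivation.leibniz_pow, derivative_X] at h'
  simp at h'
  linear_combination h'

open PowerSeries in
lemma one_sub_two_mul_ne_zero : (1 - 2 * binomialMomentSeries 0 : ℝ⟦X⟧) ≠ 0 := by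
  intro h
  simpa [h] using one_sub_two_mul_mul_derivative

open PowerSeries in
lemma binomialMomentSeries_one :
    binomialMomentSeries 1 = derivative ℝ (binomialMomentSeries 0) * X ^ 2 := by
  have h : binomialMomentSeries 1 =
      X ^ 2 + 2 * binomialMomentSeries 0 * binomialMomentSeries 1 := by
    conv_lhs => rw [binomialMomentSeries_eq]
    simp [Finset.Nat.antidiagonal_succ]
    ring
  apply mul_left_cancel₀ one_sub_two_mul_ne_zero
  linear_combination h - X ^ 2 * one_sub_two_mul_mul_derivative

open PowerSeries in
lemma one_sub_two_mul_mul_derivative_two :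
    (1 - 2 * binomialMomentSeries 0) * derivative ℝ (derivative ℝ (binomialMomentSeries 0)) =
      2 * derivative ℝ (binomialMomentSeries 0) ^ 2 := by
  have h : binomialMomentSeries 0 = X + binomialMomentSeries 0 * binomialMomentSeries 0 := by
    conv_lhs => rw [binomialMomentSeries_eq]
    simp
  have h' := congrArg (fun f => derivative ℝ (derivative ℝ f)) h
  simp only [map_add, Derivation.leibniz, derivative_X, smul_eq_mul] at h'
  simp at h'
  linear_combination h'

open PowerSeries in
lemma one_sub_two_mul_mul_derivative_three :
    (1 - 2 * binomialMomentSeries 0) *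
        derivative ℝ (derivative ℝ (derivative ℝ (binomialMomentSeries 0))) =
      6 * derivative ℝ (binomialMomentSeries 0) *
        derivative ℝ (derivative ℝ (binomialMomentSeries 0)) := by
  have h : binomialMomentSeries 0 = X + binomialMomentSeries 0 * binomialMomentSeries 0 := by
    conv_lhs => rw [binomialMomentSeries_eq]
    simp
  have h' := congrArg (fun f => derivative ℝ (derivative ℝ (derivative ℝ f))) h
  simp only [map_add, Derivation.leibniz, derivative_X, smul_eq_mul] at h'
  simp at h'
  linear_combination h'

open PowerSeries in
lemma two_mul_binomialMomentSeries_two :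
    2 * binomialMomentSeries 2 =
      derivative ℝ (derivative ℝ (binomialMomentSeries 0)) * X ^ 4 := by
  have h : binomialMomentSeries 2 =
      binomialMomentSeries 1 ^ 2 + 2 * binomialMomentSeries 0 * binomialMomentSeries 2 := by
    conv_lhs => rw [binomialMomentSeries_eq]
    simp [Finset.Nat.antidiagonal_succ]
    ring
  rw [binomialMomentSeries_one] at h
  apply mul_left_cancel₀ one_sub_two_mul_ne_zero
  linear_combination 2 * h - X ^ 4 * one_sub_two_mul_mul_derivative_two

open PowerSeries in
lemma six_mul_binomialMomentSeries_three :
    6 * binomialMomentSeries 3 =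
      derivative ℝ (derivative ℝ (derivative ℝ (binomialMomentSeries 0))) * X ^ 6 := by
  have h : binomialMomentSeries 3 =
      binomialMomentSeries 1 * (2 * binomialMomentSeries 2) +
        2 * binomialMomentSeries 0 * binomialMomentSeries 3 := by
    conv_lhs => rw [binomialMomentSeries_eq]
    simp [Finset.Nat.antidiagonal_succ]
    ring
  rw [two_mul_binomialMomentSeries_two, binomialMomentSeries_one] at h
  apply mul_left_cancel₀ one_sub_two_mul_ne_zero
  linear_combination 6 * h - X ^ 6 * one_sub_two_mul_mul_derivative_three

lemma coeff_binomialMomentSeries_zero (n : ℕ) :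
    PowerSeries.coeff n (binomialMomentSeries 0) = (treesOf n).card := by
  simp [binomialMomentSeries]

open PowerSeries in
lemma card_treesOf_recurrence (n : ℕ) :
    ((n : ℝ) + 2) * (treesOf (n + 2)).card = (4 * n + 2) * (treesOf (n + 1)).card := by
  have h : binomialMomentSeries 0 = X + binomialMomentSeries 0 * binomialMomentSeries 0 := by
    conv_lhs => rw [binomialMomentSeries_eq]
    simp
  have e : derivative ℝ (binomialMomentSeries 0) -
      C 4 * (derivative ℝ (binomialMomentSeries 0) * X) = 1 - C 2 * binomialMomentSeries 0 := by
    have h4 : (C 4 : ℝ⟦X⟧) = 4 := map_ofNat C 4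
    have h2 : (C 2 : ℝ⟦X⟧) = 2 := map_ofNat C 2
    rw [h4, h2]
    linear_combination (1 - 2 * binomialMomentSeries 0) * one_sub_two_mul_mul_derivative
      + 4 * derivative ℝ (binomialMomentSeries 0) * h
  have e' := congrArg (coeff (n + 1)) e
  simp only [map_sub, coeff_C_mul, coeff_succ_mul_X, coeff_derivative,
    coeff_binomialMomentSeries_zero, coeff_one, if_neg n.succ_ne_zero] at e'
  push_cast at e'
  linear_combination e'

lemma card_treesOf_pos (n : ℕ) : (0 : ℝ) < (treesOf (n + 1)).card := by
  induction n with
  | zero => simp [treesOf]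
  | succ n ih =>
    have h := card_treesOf_recurrence n
    have : (0 : ℝ) < ((n : ℝ) + 2) * (treesOf (n + 2)).card := by rw [h]; positivity
    exact pos_of_mul_pos_right this (by positivity)

lemma sum_branches_treesOf (n : ℕ) :
    ∑ τ ∈ treesOf (n + 2), ((branches 2 τ).choose 1 : ℝ) =
      (n + 1) * (treesOf (n + 1)).card := by
  have h := congrArg (PowerSeries.coeff (n + 2)) binomialMomentSeries_one
  rw [PowerSeries.coeff_mul_X_pow, PowerSeries.coeff_derivative,
    coeff_binomialMomentSeries_zero, binomialMomentSeries, PowerSeries.coeff_mk] at h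
  rw [h]; ring

lemma two_mul_sum_choose_two_treesOf (n : ℕ) :
    2 * ∑ τ ∈ treesOf (n + 4), ((branches 2 τ).choose 2 : ℝ) =
      (n + 1) * (n + 2) * (treesOf (n + 2)).card := by
  have h := congrArg (PowerSeries.coeff (n + 4)) two_mul_binomialMomentSeries_two
  rw [PowerSeries.coeff_mul_X_pow, PowerSeries.coeff_derivative, PowerSeries.coeff_derivative,
    coeff_binomialMomentSeries_zero, two_mul, map_add, ← two_mul, binomialMomentSeries,
    PowerSeries.coeff_mk] at h
  rw [h]; push_cast; ring

lemma six_mul_sum_choose_three_treesOf (n : ℕ) :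
    6 * ∑ τ ∈ treesOf (n + 5), ((branches 2 τ).choose 3 : ℝ) =
      n * (n + 1) * (n + 2) * (treesOf (n + 2)).card := by
  have h6 : (6 : PowerSeries ℝ) = PowerSeries.C 6 := (map_ofNat PowerSeries.C 6).symm
  have h := congrArg (PowerSeries.coeff (n + 5)) six_mul_binomialMomentSeries_three
  rw [h6, PowerSeries.coeff_C_mul] at h
  refine (Eq.trans (by simp [binomialMomentSeries]) h).trans ?_
  cases n with
  | zero => simp [PowerSeries.coeff_mul_X_pow']
  | succ n =>
    rw [show n + 1 + 5 = n + 6 by ring, PowerSeries.coeff_mul_X_pow]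
    simp only [PowerSeries.coeff_derivative, coeff_binomialMomentSeries_zero]
    push_cast
    ring

lemma cast_sq_eq_choose (s : ℕ) : (s : ℝ) ^ 2 = 2 * s.choose 2 + s.choose 1 := by
  rw [Nat.cast_choose_two, Nat.choose_one_right]; ring

lemma cast_cube_eq_choose (s : ℕ) :
    (s : ℝ) ^ 3 = 6 * s.choose 3 + 3 * (2 * s.choose 2) + s.choose 1 := by
  induction s with
  | zero => simp
  | succ s ih =>
    have h := cast_sq_eq_choose s
    rw [Nat.choose_succ_succ' s 2, Nat.choose_succ_succ' s 1, Nat.choose_succ_succ' s 0]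
    push_cast
    simp only [Nat.choose_one_right, Nat.choose_zero_right] at *
    push_cast
    linear_combination ih + 3 * h

/-- Exact second and third moments of `S_{2,n}`: for `n ≥ 4`,
`⟨S_{2,n}²⟩ = n(n−1)(n²−n−4)/(4(2n−3)(2n−5))`, and for `n ≥ 5`,
`⟨S_{2,n}³⟩ = n(n−1)(n⁴−2n³−15n²+32n+8)/(8(2n−3)(2n−5)(2n−7))`. -/
theorem exact_second_third_moments_S2 :
    (∀ n : ℕ, 4 ≤ n →
      expect n (fun τ => (BinTree.branches 2 τ : ℝ) ^ 2)
        = (n : ℝ) * ((n : ℝ) - 1) * ((n : ℝ)^2 - (n : ℝ) - 4)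
            / (4 * (2 * (n : ℝ) - 3) * (2 * (n : ℝ) - 5))) ∧
    (∀ n : ℕ, 5 ≤ n →
      expect n (fun τ => (BinTree.branches 2 τ : ℝ) ^ 3)
        = (n : ℝ) * ((n : ℝ) - 1)
            * ((n : ℝ)^4 - 2*(n : ℝ)^3 - 15*(n : ℝ)^2 + 32*(n : ℝ) + 8)
            / (8 * (2 * (n : ℝ) - 3) * (2 * (n : ℝ) - 5) * (2 * (n : ℝ) - 7))) := by
  constructor
  · intro n hn
    obtain ⟨m, rfl⟩ := Nat.exists_eq_add_of_le' hn
    have h0 := card_treesOf_pos (m + 3)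
    have r3 := card_treesOf_recurrence (m + 2)
    have r2 := card_treesOf_recurrence (m + 1)
    have s1 := sum_branches_treesOf (m + 2)
    have s2 := two_mul_sum_choose_two_treesOf m
    unfold expect
    simp_rw [fun τ => cast_sq_eq_choose (branches 2 τ)]
    rw [Finset.sum_add_distrib, ← Finset.mul_sum, s2, s1]
    push_cast at *
    have hm : (0 : ℝ) ≤ m := m.cast_nonneg
    have d1 : 2 * ((m : ℝ) + 4) - 3 ≠ 0 := by linarith
    have d2 : 2 * ((m : ℝ) + 4) - 5 ≠ 0 := by linarith
    rw [div_eq_div_iff h0.ne' (by simp [d1, d2])]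
    linear_combination
      -(2 * (m + 1) * (m + 2) * (2 * m + 5) : ℝ) * r2 - ((m + 3) * (m ^ 2 + 7 * m + 8) : ℝ) * r3
  · intro n hn
    obtain ⟨m, rfl⟩ := Nat.exists_eq_add_of_le' hn
    have h0 := card_treesOf_pos (m + 4)
    have r4 := card_treesOf_recurrence (m + 3)
    have r3 := card_treesOf_recurrence (m + 2)
    have r2 := card_treesOf_recurrence (m + 1)
    have s1 := sum_branches_treesOf (m + 3)
    have s2 := two_mul_sum_choose_two_treesOf (m + 1)
    have s3 := six_mul_sum_choose_three_treesOf m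
    unfold expect
    simp_rw [fun τ => cast_cube_eq_choose (branches 2 τ)]
    rw [Finset.sum_add_distrib, Finset.sum_add_distrib, ← Finset.mul_sum, ← Finset.mul_sum,
      ← Finset.mul_sum, s3, s2, s1]
    push_cast at *
    have hm : (0 : ℝ) ≤ m := m.cast_nonneg
    have d1 : 2 * ((m : ℝ) + 5) - 3 ≠ 0 := by linarith
    have d2 : 2 * ((m : ℝ) + 5) - 5 ≠ 0 := by linarith
    have d3 : 2 * ((m : ℝ) + 5) - 7 ≠ 0 := by linarith
    rw [div_eq_div_iff h0.ne' (by simp [d1, d2, d3])]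
    linear_combination
      -(4 * m * (m + 1) * (m + 2) * (2 * m + 7) * (2 * m + 5) : ℝ) * r2
        - (2 * (2 * m + 7) * (m + 2) * (m + 3) * (m * (m + 1) + 6 * (2 * m + 3)) : ℝ) * r3
        - ((m + 4) * ((m + 2) * (m + 3) * (m ^ 2 + 13 * m + 18)
          + 4 * (2 * m + 5) * (2 * m + 3)) : ℝ) * r4
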